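/- arXiv:2412.14091 — 2 statements merged into one kernel-verified Lean document; each statement's English description precedes it below -/
import Mathlib

section
/- Let k ≥ 1 and n ≥ k, let Ω be a symmetric n×n complex matrix, and let A be a k×n complex matrix satisfying A·Ω·Aᵀ = 0. Then for all (k−1)-element subsets I, J of {1,…,n}, the maximal minors of A satisfy Σ_{ℓ ∉ I} Σ_{m ∉ J} Ω_{ℓ,m} ε(Iℓ) ε(Jm) p_{I∪{ℓ}}(A) p_{J∪{m}}(A) = 0. In particular, for the alternating diagonal matrix Ω₀ with (Ω₀)_{ii} = (−1)^{i−1}, a matrix A with A·Ω₀·Aᵀ = 0 satisfies Σ_{ℓ ∈ {1,…,n}∖(I∪J)} (−1)^{ℓ−1} ε(Iℓ) ε(Jℓ) p_{I∪{ℓ}}(A) p_{J∪{ℓ}}(A) = 0 for all (k−1)-subsets I, J. -/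
open Matrix

/-- The Plücker coordinate `p_I(A)` of a `k × n` matrix `A`: the determinant of the
`k × k` submatrix of `A` whose columns are indexed by `I`, taken in increasing order.
(Defined to be `0` when `I` does not have exactly `k` elements.) -/
noncomputable def plucker {R : Type} [CommRing R] {k n : ℕ}
    (A : Matrix (Fin k) (Fin n) R) (I : Finset (Fin n)) : R :=
  if h : I.card = k then
    (Matrix.of fun (i : Fin k) (j : Fin k) => A i (I.orderEmbOfFin h j)).det
  else 0

/-- The sign `ε(Iℓ) = (-1)^{#{i ∈ I : i > ℓ}}`, i.e. the sign of the permutation sorting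
the string `Iℓ`. -/
def epsSign {n : ℕ} (I : Finset (Fin n)) (l : Fin n) : ℤ :=
  (-1) ^ (I.filter fun i => l < i).card

/-- The row vector of signed maximal minors of the columns indexed by `e`, whose pairing with a
column `v` is the determinant of the matrix with columns `e` followed by `v`. -/
noncomputable def minorCovector {R : Type} [CommRing R] {k n : ℕ}
    (A : Matrix (Fin (k + 1)) (Fin n) R) (e : Fin k → Fin n) (i : Fin (k + 1)) : R :=
  (-1) ^ ((i : ℕ) + k) * (A.submatrix i.succAbove e).det

theorem sum_minorCovector_mul_eq_zero {R : Type} [CommRing R] {k n : ℕ}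
    (A : Matrix (Fin (k + 1)) (Fin n) R) (e : Fin k → Fin n) (j : Fin k) :
    ∑ i, minorCovector A e i * A i (e j) = 0 := by
  have h : (A.submatrix id (Fin.snoc (α := fun _ => Fin n) e (e j))).det = 0 :=
    Matrix.det_zero_of_column_eq (i := j.castSucc) (j := Fin.last k)
      (Fin.castSucc_lt_last j).ne (fun i => by simp)
  rw [Matrix.det_succ_column _ (Fin.last k)] at h
  rw [← h]
  refine Finset.sum_congr rfl fun i _ => ?_
  have hs : (A.submatrix id (Fin.snoc (α := fun _ => Fin n) e (e j))).submatrix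
      i.succAbove (Fin.last k).succAbove = A.submatrix i.succAbove e := by
    ext a b
    simp
  rw [hs]
  simp only [minorCovector, Matrix.submatrix_apply, Fin.snoc_last, id_eq, Fin.val_last]
  ring

theorem epsSign_mul_plucker_insert {R : Type} [CommRing R] {k n : ℕ}
    (A : Matrix (Fin (k + 1)) (Fin n) R) {I : Finset (Fin n)} (hI : I.card = k)
    {l : Fin n} (hl : l ∉ I) :
    (epsSign I l : R) * plucker A (insert l I) =
      ∑ i, minorCovector A (I.orderEmbOfFin hI) i * A i l := by
  have hc : (insert l I).card = k + 1 := by rw [Finset.card_insert_of_notMem hl, hI]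
  obtain ⟨p, hp⟩ : l ∈ Set.range ((insert l I).orderEmbOfFin hc) := by
    rw [Finset.range_orderEmbOfFin]
    simp
  set f := (insert l I).orderEmbOfFin hc with hf
  have hmem : ∀ j, f j = l ∨ f j ∈ I := fun j =>
    Finset.mem_insert.mp (Finset.orderEmbOfFin_mem _ hc j)
  have he : f ∘ p.succAbove = I.orderEmbOfFin hI := by
    refine Finset.orderEmbOfFin_unique hI (fun j => ?_)
      (f.strictMono.comp (Fin.strictMono_succAbove p))
    refine (hmem _).resolve_left fun h => ?_
    exact Fin.succAbove_ne p j (f.injective (h.trans hp.symm))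
  have hcard : (I.filter fun i => l < i).card = k - p := by
    have : (I.filter fun i => l < i) = (Finset.Ioi p).map f.toEmbedding := by
      ext x
      simp only [Finset.mem_filter, Finset.mem_map, Finset.mem_Ioi]
      constructor
      · rintro ⟨hx, hlx⟩
        obtain ⟨q, rfl⟩ : x ∈ Set.range f := by
          rw [hf, Finset.range_orderEmbOfFin]
          simp [hx]
        exact ⟨q, f.lt_iff_lt.mp (hp ▸ hlx), rfl⟩
      · rintro ⟨q, hq, rfl⟩
        have hlt : l < f q := hp ▸ f.lt_iff_lt.mpr hq
        exact ⟨(hmem q).resolve_left hlt.ne', hlt⟩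
    rw [this, Finset.card_map, Fin.card_Ioi]
    omega
  have hsign : (-1 : R) ^ (k - (p : ℕ)) * (-1) ^ (p : ℕ) = (-1) ^ k := by
    rw [← pow_add, Nat.sub_add_cancel (Nat.lt_succ_iff.mp p.isLt)]
  have hpp : (-1 : R) ^ (k - (p : ℕ)) * plucker A (insert l I) =
      ∑ i : Fin (k + 1), (-1) ^ (k - (p : ℕ)) *
        ((-1) ^ ((i : ℕ) + p) * A i l * (A.submatrix i.succAbove (f ∘ p.succAbove)).det) := by
    rw [plucker, dif_pos hc, Matrix.det_succ_column _ p, Finset.mul_sum]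
    refine Finset.sum_congr rfl fun i _ => ?_
    rw [Matrix.of_apply, ← hf, hp]
    rfl
  rw [epsSign, hcard]
  push_cast
  rw [hpp, he]
  refine Finset.sum_congr rfl fun i _ => ?_
  rw [minorCovector, pow_add, pow_add, ← hsign]
  ring

theorem vecMul_minorCovector {R : Type} [CommRing R] {k n : ℕ}
    (A : Matrix (Fin (k + 1)) (Fin n) R) {I : Finset (Fin n)} (hI : I.card = k) (l : Fin n) :
    (minorCovector A (I.orderEmbOfFin hI) ᵥ* A) l =
      if l ∈ Iᶜ then (epsSign I l : R) * plucker A (insert l I) else 0 := by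
  simp only [Matrix.vecMul, dotProduct, Finset.mem_compl]
  split_ifs with hl
  · obtain ⟨j, rfl⟩ : l ∈ Set.range (I.orderEmbOfFin hI) := by
      rw [Finset.range_orderEmbOfFin]
      exact hl
    exact sum_minorCovector_mul_eq_zero A _ j
  · exact (epsSign_mul_plucker_insert A hI hl).symm

/-- The quadratic relations between the maximal minors of `A`; symmetry of `Ω` is not needed. -/
theorem sum_mul_plucker_insert_eq_zero {R : Type} [CommRing R] {k n : ℕ}
    (Ω : Matrix (Fin n) (Fin n) R) (A : Matrix (Fin (k + 1)) (Fin n) R)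
    (hA : A * Ω * Aᵀ = 0) {I J : Finset (Fin n)} (hI : I.card = k) (hJ : J.card = k) :
    ∑ l ∈ Iᶜ, ∑ m ∈ Jᶜ, (Ω l m * (epsSign I l : R) * (epsSign J m : R) *
      plucker A (insert l I) * plucker A (insert m J)) = 0 := by
  set u := minorCovector A (I.orderEmbOfFin hI)
  set v := minorCovector A (J.orderEmbOfFin hJ)
  have h : (u ᵥ* A) ⬝ᵥ (Ω *ᵥ (v ᵥ* A)) = 0 := by
    rw [← Matrix.mulVec_transpose A v, Matrix.mulVec_mulVec, ← Matrix.dotProduct_mulVec,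
      Matrix.mulVec_mulVec, ← Matrix.mul_assoc, hA, Matrix.zero_mulVec, dotProduct_zero]
  rw [← h]
  simp only [dotProduct, Matrix.mulVec, u, v, vecMul_minorCovector, ite_mul, zero_mul, mul_ite,
    mul_zero, Finset.sum_ite_mem, Finset.univ_inter, Finset.mul_sum]
  refine Finset.sum_subset_zero_on_sdiff (Finset.subset_univ _) (fun l hl => ?_) fun l hl => ?_
  · simp only [if_neg (Finset.mem_sdiff.mp hl).2, Finset.sum_const_zero]
  · simp only [if_pos hl]
    exact Finset.sum_congr rfl fun m _ => by ring

/-- For a symmetric `n × n` complex matrix `Ω` and a `k × n` matrix `A`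
with `A * Ω * Aᵀ = 0`, the maximal minors of `A` satisfy
`∑_{ℓ ∉ I} ∑_{m ∉ J} Ω_{ℓ m} ε(Iℓ) ε(Jm) p_{I∪{ℓ}}(A) p_{J∪{m}}(A) = 0` for all
`(k-1)`-subsets `I, J`.  In particular, for the alternating diagonal matrix `Ω₀` with
entries `(-1)^{i-1}` (here `(-1)^i` in zero-based indexing), a matrix with
`A * Ω₀ * Aᵀ = 0` satisfies
`∑_{ℓ ∉ I ∪ J} (-1)^{ℓ-1} ε(Iℓ) ε(Jℓ) p_{I∪{ℓ}}(A) p_{J∪{ℓ}}(A) = 0`. -/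
theorem statement1 {k n : ℕ} (hk : 1 ≤ k) (hkn : k ≤ n) :
    (∀ Ω : Matrix (Fin n) (Fin n) ℂ, Ωᵀ = Ω →
      ∀ A : Matrix (Fin k) (Fin n) ℂ, A * Ω * Aᵀ = 0 →
      ∀ I J : Finset (Fin n), I.card = k - 1 → J.card = k - 1 →
      ∑ l ∈ Iᶜ, ∑ m ∈ Jᶜ, (Ω l m * (epsSign I l : ℂ) * (epsSign J m : ℂ) *
        plucker A (insert l I) * plucker A (insert m J)) = 0) ∧
    (∀ A : Matrix (Fin k) (Fin n) ℂ,
      A * Matrix.diagonal (fun i : Fin n => (-1 : ℂ) ^ (i : ℕ)) * Aᵀ = 0 →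
      ∀ I J : Finset (Fin n), I.card = k - 1 → J.card = k - 1 →
      ∑ l ∈ (I ∪ J)ᶜ, ((-1 : ℂ) ^ (l : ℕ) * (epsSign I l : ℂ) * (epsSign J l : ℂ) *
        plucker A (insert l I) * plucker A (insert l J)) = 0) := by
  obtain ⟨k, rfl⟩ : ∃ j, k = j + 1 := ⟨k - 1, by omega⟩
  refine ⟨fun Ω _ A hA I J hI hJ => sum_mul_plucker_insert_eq_zero Ω A hA hI hJ,
    fun A hA I J hI hJ => ?_⟩
  rw [← sum_mul_plucker_insert_eq_zero _ A hA hI hJ, Finset.compl_union, ← Finset.sum_ite_mem]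
  refine Finset.sum_congr rfl fun l _ => ?_
  simp only [Matrix.diagonal_apply, ite_mul, zero_mul, Finset.sum_ite_eq]
end

section
/- Let k ≥ 1 and n ≥ k, and let A be a k×n complex matrix of rank k whose maximal minors satisfy Σ_{ℓ ∈ {1,…,n}∖(I∪J)} ε(Iℓ) ε(Jℓ) p_{I∪{ℓ}}(A) p_{J∪{ℓ}}(A) = 0 for all (k−1)-element subsets I, J of {1,…,n}. Then A·Aᵀ = 0; equivalently, the row space of A is totally isotropic with respect to the standard symmetric bilinear form (x,y) = Σ_{i=1}^n x_i y_i on ℂⁿ. -/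
open Matrix

/-- A matrix of full row rank has an invertible maximal square submatrix, with the chosen columns
in increasing order. -/
lemma exists_orderEmb_det_ne_zero {K : Type*} [Field K] {k n : ℕ} (A : Matrix (Fin k) (Fin n) K)
    (hrank : A.rank = k) : ∃ f : Fin k ↪o Fin n, (A.submatrix id f).det ≠ 0 := by
  obtain ⟨κ, a, ha, hspan, hli⟩ := exists_linearIndependent' K A.col
  have : Fintype κ := Fintype.ofInjective a ha
  have hcard : Fintype.card κ = k := by
    rw [← hrank, rank_eq_finrank_span_cols, ← hspan, finrank_span_eq_card hli]
  have hc : (Finset.univ.map ⟨a, ha⟩).card = k := by simpa using hcard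
  set f := (Finset.univ.map ⟨a, ha⟩).orderEmbOfFin hc
  refine ⟨f, ?_⟩
  have hmem : ∀ j, ∃ x, a x = f j := fun j => by
    obtain ⟨x, -, hx⟩ := Finset.mem_map.1
      (Finset.orderEmbOfFin_mem (Finset.univ.map ⟨a, ha⟩) hc j)
    exact ⟨x, hx⟩
  choose σ hσ using hmem
  have hσi : Function.Injective σ := fun i j hij => f.injective (by rw [← hσ, ← hσ, hij])
  have h2 : LinearIndependent K (A.submatrix id f).col := by
    have h3 : (A.submatrix id f).col = (A.col ∘ a) ∘ σ := by
      ext j i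
      simp [hσ]
    rw [h3]
    exact hli.comp σ hσi
  rw [Matrix.linearIndependent_cols_iff_isUnit, Matrix.isUnit_iff_isUnit_det] at h2
  exact h2.ne_zero

/-- Up to a sign that does not depend on `l`, the signed Plücker coordinate at `I ∪ {l}` is the
determinant of the submatrix with columns `l` and then `I` in increasing order. -/
lemma epsSign_mul_plucker_insert_s2 {R : Type} [CommRing R] {m n : ℕ}
    (A : Matrix (Fin (m + 1)) (Fin n) R) (e : Fin m ↪o Fin n) {l : Fin n}
    (hl : l ∉ Finset.univ.map e.toEmbedding) :
    (epsSign (Finset.univ.map e.toEmbedding) l : R) *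
        plucker A (insert l (Finset.univ.map e.toEmbedding)) =
      (-1) ^ m * (A.submatrix id (Fin.cons l e : Fin (m + 1) → Fin n)).det := by
  set I := Finset.univ.map e.toEmbedding with hI
  have hIc : I.card = m := by simp [hI]
  have hc : (insert l I).card = m + 1 := by rw [Finset.card_insert_of_notMem hl, hIc]
  set g := (insert l I).orderEmbOfFin hc with hg
  obtain ⟨p, hp⟩ : ∃ p, g p = l := by
    have : l ∈ Set.range g := by
      rw [hg, Finset.range_orderEmbOfFin]; simp
    exact this
  have hge : ∀ j, g (p.succAbove j) = e j := by
    have hmem : ∀ j, g (p.succAbove j) ∈ I := fun j => by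
      have h1 := Finset.orderEmbOfFin_mem (insert l I) hc (p.succAbove j)
      rcases Finset.mem_insert.1 h1 with h2 | h2
      · exact absurd (g.injective (h2.trans hp.symm)) (Fin.succAbove_ne p j)
      · exact h2
    have h1 := Finset.orderEmbOfFin_unique hIc hmem
      (g.strictMono.comp (Fin.strictMono_succAbove p))
    have h2 := Finset.orderEmbOfFin_unique hIc (f := e) (fun j => by simp [hI]) e.strictMono
    exact fun j => congrFun (h1.trans h2.symm) j
  have hfilter : I.filter (fun i => l < i) = (Finset.Ioi p).map g.toEmbedding := by
    ext x
    simp only [Finset.mem_filter, Finset.mem_map, Finset.mem_Ioi, RelEmbedding.coe_toEmbedding]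
    constructor
    · rintro ⟨hx, hlx⟩
      obtain ⟨j, -, rfl⟩ := Finset.mem_map.1 hx
      refine ⟨p.succAbove j, ?_, hge j⟩
      rw [← g.lt_iff_lt, hp, hge]
      exact hlx
    · rintro ⟨q, hq, rfl⟩
      obtain ⟨j, rfl⟩ := Fin.exists_succAbove_eq hq.ne'
      refine ⟨by rw [hge]; simp [hI], ?_⟩
      rw [← hp]
      exact g.strictMono hq
  have heps : epsSign I l = (-1) ^ (m - (p : ℕ)) := by
    rw [epsSign, hfilter, Finset.card_map, Fin.card_Ioi]
    congr 1
  have hpm : (p : ℕ) ≤ m := Nat.lt_succ_iff.1 p.2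
  rw [heps, plucker, dif_pos hc, det_succ_column _ p, det_succ_column_zero, Finset.mul_sum,
    Finset.mul_sum]
  refine Finset.sum_congr rfl fun i _ => ?_
  have h1 : (of fun i j => A i ((insert l I).orderEmbOfFin hc j)).submatrix i.succAbove
      p.succAbove = A.submatrix i.succAbove e := by
    ext a b
    simp [← hg, hge]
  have h2 : (A.submatrix id (Fin.cons l e : Fin (m + 1) → Fin n)).submatrix i.succAbove Fin.succ =
      A.submatrix i.succAbove e := by
    ext a b
    simp
  rw [h1, h2]
  have hs : ((-1 : R)) ^ m = (-1) ^ (m - (p : ℕ)) * (-1) ^ (p : ℕ) := by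
    rw [← pow_add, Nat.sub_add_cancel hpm]
  simp only [of_apply, ← hg, hp, submatrix_apply, Fin.cons_zero, id]
  push_cast
  rw [hs, pow_add]
  ring

/-- Prepending a column to the columns of a square submatrix `B` with the `j`-th one removed gives,
up to sign, an entry of `B.adjugate * A`. -/
lemma det_submatrix_cons_succAbove {R : Type*} [CommRing R] {m n : ℕ}
    (A : Matrix (Fin (m + 1)) (Fin n) R) (f : Fin (m + 1) → Fin n) (j : Fin (m + 1)) (l : Fin n) :
    (A.submatrix id (Fin.cons l (f ∘ j.succAbove) : Fin (m + 1) → Fin n)).det =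
      (-1) ^ (j : ℕ) * ((A.submatrix id f).adjugate * A) j l := by
  rw [det_succ_column_zero, mul_apply, Finset.mul_sum]
  refine Finset.sum_congr rfl fun i _ => ?_
  have h2 : (A.submatrix id (Fin.cons l (f ∘ j.succAbove) : Fin (m + 1) → Fin n)).submatrix
      i.succAbove Fin.succ = (A.submatrix id f).submatrix i.succAbove j.succAbove := by
    ext a b
    simp
  rw [h2, adjugate_fin_succ_eq_det_submatrix]
  have hs : (-1 : R) ^ (j : ℕ) * (-1) ^ (j : ℕ) = 1 := by
    rw [← mul_pow]; simp
  simp only [submatrix_apply, Fin.cons_zero, id, pow_add]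
  linear_combination (-(-1) ^ (i : ℕ) * A i l *
    ((A.submatrix id f).submatrix i.succAbove j.succAbove).det) * hs

/-- If `A` is a `k × n` complex matrix of rank `k` whose maximal minors
satisfy `∑_{ℓ ∉ I ∪ J} ε(Iℓ) ε(Jℓ) p_{I∪{ℓ}}(A) p_{J∪{ℓ}}(A) = 0` for all
`(k-1)`-subsets `I, J`, then `A * Aᵀ = 0`, i.e. the row space of `A` is totally isotropic
for the standard symmetric bilinear form. -/
theorem statement2 {k n : ℕ} (hk : 1 ≤ k) (hkn : k ≤ n)
    (A : Matrix (Fin k) (Fin n) ℂ) (hrank : A.rank = k)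
    (h : ∀ I J : Finset (Fin n), I.card = k - 1 → J.card = k - 1 →
      ∑ l ∈ (I ∪ J)ᶜ, ((epsSign I l : ℂ) * (epsSign J l : ℂ) *
        plucker A (insert l I) * plucker A (insert l J)) = 0) :
    A * Aᵀ = 0 := by
  obtain ⟨m, rfl⟩ : ∃ m, k = m + 1 := ⟨k - 1, by omega⟩
  obtain ⟨f, hf⟩ := exists_orderEmb_det_ne_zero A hrank
  set B := A.submatrix id f
  have key : (B.adjugate * A) * (B.adjugate * A)ᵀ = 0 := by
    ext i j
    let e : Fin (m + 1) → (Fin m ↪o Fin n) := fun j => (Fin.succAboveOrderEmb j).trans f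
    let S : Fin (m + 1) → Finset (Fin n) := fun j => Finset.univ.map (e j).toEmbedding
    let D : Fin (m + 1) → Fin n → ℂ := fun j l =>
      (A.submatrix id (Fin.cons l (e j) : Fin (m + 1) → Fin n)).det
    have hD : ∀ j l, D j l = (-1) ^ (j : ℕ) * (B.adjugate * A) j l := fun j l =>
      det_submatrix_cons_succAbove A f j l
    have hD0 : ∀ j l, l ∈ S j → D j l = 0 := by
      intro j l hl
      obtain ⟨q, -, rfl⟩ := Finset.mem_map.1 hl
      exact det_zero_of_column_eq (Fin.succ_ne_zero q) (fun a => by simp)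
    have hsum : ∑ l, D i l * D j l = 0 := by
      rw [← Finset.sum_subset (Finset.subset_univ (S i ∪ S j)ᶜ),
        ← h (S i) (S j) (by simp [S]) (by simp [S])]
      · refine Finset.sum_congr rfl fun l hl => ?_
        simp only [Finset.mem_compl, Finset.mem_union, not_or] at hl
        have h1 := epsSign_mul_plucker_insert_s2 A (e i) hl.1
        have h2 := epsSign_mul_plucker_insert_s2 A (e j) hl.2
        have hs : (-1 : ℂ) ^ m * (-1) ^ m = 1 := by
          rw [← mul_pow]; simp
        calc D i l * D j l = ((-1) ^ m * D i l) * ((-1) ^ m * D j l) := by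
              linear_combination (-D i l * D j l) * hs
          _ = _ := by
              rw [← h1, ← h2]; ring
      · intro l _ hl
        simp only [Finset.mem_compl, Finset.mem_union, not_not] at hl
        rcases hl with hl | hl <;> simp [hD0 _ _ hl]
    simp only [hD] at hsum
    have hsum' : ((-1 : ℂ) ^ (i : ℕ) * (-1) ^ (j : ℕ)) *
        ∑ l, (B.adjugate * A) i l * (B.adjugate * A) j l = 0 := by
      rw [← hsum, Finset.mul_sum]
      exact Finset.sum_congr rfl fun l _ => by ring
    rw [mul_apply, Matrix.zero_apply]
    exact (mul_eq_zero.1 hsum').resolve_left (by simp)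
  have hadj : IsUnit B.adjugate := by
    rw [isUnit_iff_isUnit_det, det_adjugate]
    exact (isUnit_iff_ne_zero.2 hf).pow _
  have hadjT : IsUnit B.adjugateᵀ := (isUnit_transpose B.adjugate).2 hadj
  rw [transpose_mul, Matrix.mul_assoc, hadj.mul_right_eq_zero, ← Matrix.mul_assoc,
    hadjT.mul_left_eq_zero] at key
  exact key
end
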